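/- Let 0 < η1 < 1, η2 < η1, and γ = η1 − η2 > 0. Let (k_n)_{n≥1} satisfy |k_n − π/2| ≤ C0 n^{−η1} for all n ≥ 1 and some C0 > 0, and let θ : ℕ → ℝ satisfy: for every ε > 0 there exists C_ε > 0 with |θ(n+1) − θ(n) − k_n| ≤ C_ε max(n^{−γ+ε}, n^{−1}) for all n ≥ 1. Define r = γ−1 if γ ≥ 1/2 and η2 > 0; r = −γ if γ < 1/2 and η2 > 0; r = η1−1 if γ ≥ 1/2 and η2 ≤ 0; r = η1−2γ if γ < 1/2 and η2 ≤ 0. Let δ > 0 and let f : ℕ → ℝ satisfy f(n) = O(n^{r−δ}) and f(n+1) − f(n) = O(n^{r−1−δ}) as n → ∞. Then lim_{n→∞} (1/F_γ(n)) Σ_{j=1}^{n} f(j) cos(2θ(j)) = 0, where F_γ(n) = log n if γ ≥ 1/2 and F_γ(n) = n^{1−2γ} if γ < 1/2. -/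

import Mathlib

open Filter Real Asymptotics

/-- Along the naturals, a smaller power is negligible compared with a larger one. -/
theorem natCast_rpow_isLittleO_rpow {a b : ℝ} (h : a < b) :
    (fun n : ℕ => (n : ℝ) ^ a) =o[atTop] fun n : ℕ => (n : ℝ) ^ b := by
  have hpos : ∀ᶠ n : ℕ in atTop, (0 : ℝ) < n :=
    eventually_atTop.2 ⟨1, fun n hn => by exact_mod_cast hn⟩
  refine (isLittleO_iff_tendsto' (hpos.mono fun n hn h0 =>
    absurd h0 (Real.rpow_pos_of_pos hn b).ne')).2 ?_
  refine ((tendsto_rpow_neg_atTop (sub_pos.2 h)).comp tendsto_natCast_atTop_atTop).congr'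
    (hpos.mono fun n hn => ?_)
  rw [Function.comp_apply, neg_sub, Real.rpow_sub hn]

/-- Along the naturals, a power is dominated by any power that is at least as large. -/
theorem natCast_rpow_isBigO_rpow {a b : ℝ} (h : a ≤ b) :
    (fun n : ℕ => (n : ℝ) ^ a) =O[atTop] fun n : ℕ => (n : ℝ) ^ b :=
  IsBigO.of_bound 1 (eventually_atTop.2 ⟨1, fun n hn => by
    rw [one_mul, Real.norm_of_nonneg (by positivity), Real.norm_of_nonneg (by positivity)]
    exact Real.rpow_le_rpow_of_exponent_le (by exact_mod_cast hn) h⟩)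

/-- If `F` is monotone and tends to infinity, with increments at least of order `n ^ (-q)`, then
the partial sums of a sequence that is `O(n ^ a)` with `a < -q` are `o(F)`. -/
theorem sum_range_isLittleO_of_rpow {F h : ℕ → ℝ} {q a : ℝ} (hmono : Monotone F)
    (hF : Tendsto F atTop atTop)
    (hinc : (fun n : ℕ => (n : ℝ) ^ (-q)) =O[atTop] fun n => F (n + 1) - F n)
    (ha : a < -q) (hh : h =O[atTop] fun n : ℕ => (n : ℝ) ^ a) :
    (fun n => ∑ j ∈ Finset.range n, h j) =o[atTop] F := by
  have h1 : h =o[atTop] fun n => F (n + 1) - F n :=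
    hh.trans_isLittleO ((natCast_rpow_isLittleO_rpow ha).trans_isBigO hinc)
  have hsum : (fun n => ∑ j ∈ Finset.range n, (F (j + 1) - F j)) = fun n => F n - F 0 := by
    ext n; exact Finset.sum_range_sub F n
  have h2 := h1.sum_range (fun n => sub_nonneg.2 (hmono n.le_succ))
    (by rw [hsum]; exact tendsto_atTop_add_const_right _ (-F 0) hF)
  rw [hsum] at h2
  exact h2.trans_isBigO ((isBigO_refl _ _).sub
    (isLittleO_const_left.2 (Or.inr (tendsto_norm_atTop_atTop.comp hF))).isBigO)

/-- The increments of `log n` are at least of order `1 / n`. -/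
theorem rpow_neg_one_isBigO_log_sub :
    (fun n : ℕ => (n : ℝ) ^ (-1 : ℝ)) =O[atTop]
      fun n : ℕ => Real.log ((n + 1 : ℕ) : ℝ) - Real.log n := by
  refine IsBigO.of_bound 2 (eventually_atTop.2 ⟨1, fun n hn => ?_⟩)
  have hn' : (1 : ℝ) ≤ n := by exact_mod_cast hn
  have h0 : (0 : ℝ) < n := by linarith
  have key : ((n : ℝ) + 1)⁻¹ ≤ Real.log ((n : ℝ) + 1) - Real.log n := by
    rw [← Real.log_div (by positivity) (by positivity)]
    refine le_trans (le_of_eq ?_) (Real.one_sub_inv_le_log_of_pos (by positivity))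
    field_simp
    ring
  have hle : (n : ℝ)⁻¹ ≤ 2 * ((n : ℝ) + 1)⁻¹ := by
    rw [← div_eq_mul_inv, inv_le_comm₀ h0 (by positivity), inv_div]
    linarith
  push_cast
  rw [Real.rpow_neg_one, Real.norm_of_nonneg (by positivity),
    Real.norm_of_nonneg (le_trans (by positivity) key)]
  linarith

/-- The increments of `n ^ p`, for `0 < p ≤ 1`, are at least of order `n ^ (p - 1)`. -/
theorem rpow_isBigO_rpow_sub {p : ℝ} (hp : 0 < p) (hp1 : p ≤ 1) :
    (fun n : ℕ => (n : ℝ) ^ (p - 1)) =O[atTop]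
      fun n : ℕ => ((n + 1 : ℕ) : ℝ) ^ p - (n : ℝ) ^ p := by
  refine IsBigO.of_bound (2 / p) (eventually_atTop.2 ⟨1, fun n hn => ?_⟩)
  have hn' : (1 : ℝ) ≤ n := by exact_mod_cast hn
  have h0 : (0 : ℝ) < n := by linarith
  push_cast
  generalize (n : ℝ) = x at hn' h0 ⊢
  have hpow : x ^ p ≤ (x + 1) ^ p := Real.rpow_le_rpow h0.le (by linarith) hp.le
  have bern : (x / (x + 1)) ^ p ≤ 1 - p / (x + 1) := by
    have hs : (-1 : ℝ) ≤ -(x + 1)⁻¹ := by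
      have : (x + 1)⁻¹ ≤ 1 := inv_le_one_of_one_le₀ (by linarith)
      linarith
    have := rpow_one_add_le_one_add_mul_self hs hp.le hp1
    convert this using 1
    · congr 1; field_simp; ring
    · field_simp; ring
  rw [Real.div_rpow h0.le (by positivity), div_le_iff₀ (by positivity)] at bern
  have hA : x ^ (p - 1) = x ^ p / x := by
    rw [Real.rpow_sub_one h0.ne']
  rw [Real.norm_of_nonneg (by positivity), Real.norm_of_nonneg (by linarith), hA]
  have h3 : p / (x + 1) * (x + 1) ^ p ≤ (x + 1) ^ p - x ^ p := by linarith
  calc x ^ p / x ≤ (x + 1) ^ p / x := by gcongr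
    _ ≤ 2 / p * (p / (x + 1) * (x + 1) ^ p) := by
      have : 2 / p * (p / (x + 1) * (x + 1) ^ p) = (x + 1) ^ p * (2 / (x + 1)) := by
        field_simp
      rw [this, div_eq_mul_inv]
      gcongr
      rw [inv_eq_one_div, div_le_div_iff₀ h0 (by positivity)]
      linarith
    _ ≤ _ := by gcongr

/-- Summation by parts for a sequence `c` that nearly changes sign at each step. -/
theorem two_mul_sum_Icc_mul (f c : ℕ → ℝ) (n : ℕ) :
    2 * ∑ j ∈ Finset.Icc 1 n, f j * c j =
      ∑ j ∈ Finset.range n, (f j * (c j + c (j + 1)) + (f (j + 1) - f j) * c (j + 1)) +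
        (f n * c n - f 0 * c 0) := by
  induction n with
  | zero => simp
  | succ n ih =>
    rw [Finset.sum_Icc_succ_top (by omega), Finset.sum_range_succ, mul_add, ih]
    ring

/-- Increasing the angle `x` by nearly `π / 2` nearly changes the sign of `cos (2 * x)`. -/
theorem abs_cos_add_cos_le (x y : ℝ) :
    |Real.cos (2 * x) + Real.cos (2 * y)| ≤ 2 * |y - x - π / 2| := by
  have h := Real.abs_cos_sub_cos_le (2 * x) (2 * y - π)
  rw [Real.cos_sub_pi, sub_neg_eq_add] at h
  refine h.trans (le_of_eq ?_)
  rw [show 2 * x - (2 * y - π) = -(2 * (y - x - π / 2)) by ring, abs_neg, abs_mul, abs_two]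

/-- Averaging against a growth function `F` whose increments are at least of order `n ^ (-q)`. -/
theorem sum_mul_cos_isLittleO {η γ C0 q r δ : ℝ} {k θ f F : ℕ → ℝ}
    (hk : ∀ n : ℕ, 1 ≤ n → |k n - π / 2| ≤ C0 * (n : ℝ) ^ (-η))
    (hθ : ∀ ε : ℝ, 0 < ε → ∃ Cε : ℝ, 0 < Cε ∧ ∀ n : ℕ, 1 ≤ n →
      |θ (n + 1) - θ n - k n| ≤ Cε * max ((n : ℝ) ^ (-γ + ε)) ((n : ℝ)⁻¹))
    (hδ : 0 < δ)
    (hf : f =O[atTop] fun n : ℕ => (n : ℝ) ^ (r - δ))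
    (hf' : (fun n : ℕ => f (n + 1) - f n) =O[atTop] fun n : ℕ => (n : ℝ) ^ (r - 1 - δ))
    (hrη : r - η ≤ -q) (hrγ : r - γ ≤ -q) (hr1 : r - 1 ≤ -q)
    (hmono : Monotone F) (hF : Tendsto F atTop atTop)
    (hinc : (fun n : ℕ => (n : ℝ) ^ (-q)) =O[atTop] fun n => F (n + 1) - F n) :
    (fun n => ∑ j ∈ Finset.Icc 1 n, f j * Real.cos (2 * θ j)) =o[atTop] F := by
  obtain ⟨C, hC, hθC⟩ := hθ (δ / 2) (by linarith)
  set c : ℕ → ℝ := fun n => Real.cos (2 * θ n) with hc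
  have hconst (a : ℝ) : (fun _ : ℕ => a) =o[atTop] F :=
    isLittleO_const_left.2 (Or.inr (tendsto_norm_atTop_atTop.comp hF))
  have hcb (i : ℕ) : (fun n => c (n + i)) =O[atTop] fun _ => (1 : ℝ) :=
    IsBigO.of_bound 1 (Eventually.of_forall fun n => by
      simpa [hc] using Real.abs_cos_le_one (2 * θ (n + i)))
  have hcc : (fun n => c n + c (n + 1)) =O[atTop] fun n : ℕ => (n : ℝ) ^ (-q - r + δ / 2) := by
    have hbd : (fun n => c n + c (n + 1)) =O[atTop] fun n : ℕ =>
        2 * (C0 * (n : ℝ) ^ (-η) + C * ((n : ℝ) ^ (-γ + δ / 2) + (n : ℝ) ^ (-1 : ℝ))) := by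
      refine IsBigO.of_bound 1 (eventually_atTop.2 ⟨1, fun n hn => ?_⟩)
      rw [one_mul]
      refine le_trans ?_ (le_abs_self _)
      refine (abs_cos_add_cos_le _ _).trans ?_
      have h1 := hk n hn
      have h2 := hθC n hn
      have h3 : max ((n : ℝ) ^ (-γ + δ / 2)) ((n : ℝ)⁻¹) ≤
          (n : ℝ) ^ (-γ + δ / 2) + (n : ℝ) ^ (-1 : ℝ) := by
        rw [Real.rpow_neg_one]
        exact max_le_add_of_nonneg (by positivity) (by positivity)
      have h4 : |θ (n + 1) - θ n - π / 2| ≤ |θ (n + 1) - θ n - k n| + |k n - π / 2| := by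
        simpa using abs_sub_le (θ (n + 1) - θ n) (k n) (π / 2)
      have h5 := mul_le_mul_of_nonneg_left h3 hC.le
      linarith
    refine hbd.trans (IsBigO.const_mul_left (IsBigO.add ?_ (IsBigO.const_mul_left ?_ _)) _)
    · exact (natCast_rpow_isBigO_rpow (by linarith)).const_mul_left _
    · exact (natCast_rpow_isBigO_rpow (by linarith)).add (natCast_rpow_isBigO_rpow (by linarith))
  have hd : (fun n => f n * (c n + c (n + 1)) + (f (n + 1) - f n) * c (n + 1)) =O[atTop]
      fun n : ℕ => (n : ℝ) ^ (-q - δ / 2) := by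
    refine IsBigO.add ?_ ?_
    · refine (hf.mul hcc).trans (EventuallyEq.isBigO (eventually_atTop.2 ⟨1, fun n hn => ?_⟩))
      have h0 : (0 : ℝ) < n := by exact_mod_cast hn
      change (n : ℝ) ^ (r - δ) * (n : ℝ) ^ (-q - r + δ / 2) = _
      rw [← Real.rpow_add h0]
      congr 1
      ring
    · refine (hf'.mul (hcb 1)).trans ?_
      simp only [mul_one]
      exact natCast_rpow_isBigO_rpow (by linarith)
  have hfF : f =o[atTop] F := by
    have h := sum_range_isLittleO_of_rpow hmono hF hinc (by linarith) hf'
    simp only [Finset.sum_range_sub] at h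
    simpa using h.add (hconst (f 0))
  have hfc : (fun n => f n * c n) =o[atTop] F := by
    simpa using hfF.mul_isBigO (hcb 0)
  have hmain := ((sum_range_isLittleO_of_rpow hmono hF hinc (by linarith) hd).add
    (hfc.sub (hconst (f 0 * c 0)))).const_mul_left (1 / 2)
  refine hmain.congr_left fun n => ?_
  rw [← two_mul_sum_Icc_mul f c n]
  ring

/-- **Proposition (averaging of oscillatory sums against Prüfer angles).**
With `r` determined by the four cases of the parameters and `F_γ(n) = log n`
(for `γ ≥ 1/2`) or `n^{1-2γ}` (for `γ < 1/2`), any `f` with `f(n) = O(n^{r-δ})` and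
`f(n+1) - f(n) = O(n^{r-1-δ})` satisfies
`(1/F_γ(n)) ∑_{j=1}^n f(j) cos(2θ(j)) → 0`. -/
theorem oscillatory_sum_average_vanishes
    (η1 η2 C0 : ℝ)
    (hη1 : 0 < η1) (hη1' : η1 < 1) (hη2 : η2 < η1) (hγ : 0 < η1 - η2) (hC0 : 0 < C0)
    (k : ℕ → ℝ) (hk : ∀ n : ℕ, 1 ≤ n → |k n - π / 2| ≤ C0 * (n : ℝ) ^ (-η1))
    (θ : ℕ → ℝ)
    (hθ : ∀ ε : ℝ, 0 < ε → ∃ Cε : ℝ, 0 < Cε ∧ ∀ n : ℕ, 1 ≤ n →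
      |θ (n + 1) - θ n - k n| ≤ Cε * max ((n : ℝ) ^ (-(η1 - η2) + ε)) ((n : ℝ)⁻¹))
    (r : ℝ)
    (hr : r = if 1 / 2 ≤ η1 - η2 then (if 0 < η2 then η1 - η2 - 1 else η1 - 1)
      else (if 0 < η2 then -(η1 - η2) else η1 - 2 * (η1 - η2)))
    (δ : ℝ) (hδ : 0 < δ)
    (f : ℕ → ℝ)
    (hf : f =O[atTop] fun n : ℕ => (n : ℝ) ^ (r - δ))
    (hf' : (fun n : ℕ => f (n + 1) - f n) =O[atTop] fun n : ℕ => (n : ℝ) ^ (r - 1 - δ)) :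
    Tendsto
      (fun n : ℕ =>
        (1 / (if 1 / 2 ≤ η1 - η2 then Real.log n else (n : ℝ) ^ (1 - 2 * (η1 - η2)))) *
          ∑ j ∈ Finset.Icc 1 n, f j * Real.cos (2 * θ j))
      atTop (nhds 0) := by
  simp only [one_div_mul_eq_div]
  refine IsLittleO.tendsto_div_nhds_zero ?_
  by_cases h1 : 1 / 2 ≤ η1 - η2
  · simp only [if_pos h1] at hr ⊢
    have hlog : Monotone fun n : ℕ => Real.log n := fun a b hab => by
      rcases Nat.eq_zero_or_pos a with rfl | ha
      · simpa using Real.log_natCast_nonneg b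
      · exact Real.log_le_log (by exact_mod_cast ha) (by exact_mod_cast hab)
    refine sum_mul_cos_isLittleO (q := 1) hk hθ hδ hf hf' ?_ ?_ ?_ hlog
      (Real.tendsto_log_atTop.comp tendsto_natCast_atTop_atTop) rpow_neg_one_isBigO_log_sub
    all_goals split_ifs at hr <;> linarith
  · simp only [if_neg h1] at hr ⊢
    have hp : 0 < 1 - 2 * (η1 - η2) := by linarith
    have hpow : Monotone fun n : ℕ => (n : ℝ) ^ (1 - 2 * (η1 - η2)) := fun a b hab =>
      Real.rpow_le_rpow (by positivity) (by exact_mod_cast hab) hp.le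
    refine sum_mul_cos_isLittleO (q := 2 * (η1 - η2)) hk hθ hδ hf hf' ?_ ?_ ?_ hpow
      ((tendsto_rpow_atTop hp).comp tendsto_natCast_atTop_atTop) ?_
    · split_ifs at hr <;> linarith
    · split_ifs at hr <;> linarith
    · split_ifs at hr <;> linarith
    · convert rpow_isBigO_rpow_sub hp (by linarith) using 3
      ring
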